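/- If P is a uniformly recurrent packing of a body K in ℝ^d and P is dense (its density equals the packing density δ(K)), then P is uniformly dense: the convergence of vol-fraction in balls B(p,r) to δ(K) as r → ∞ is uniform in the center p. -/

import Mathlib

open MeasureTheory Metric Filter Pointwise
open scoped ENNReal NNReal

noncomputable section

abbrev Euc (d : ℕ) : Type := EuclideanSpace ℝ (Fin d)

/-- A body: a compact domain (compact set equal to the closure of its interior). -/
def IsBody {d : ℕ} (K : Set (Euc d)) : Prop :=
  IsCompact K ∧ K = closure (interior K)

/-- `D` is an isometric copy of `K`. -/
def IsIsomCopy {d : ℕ} (K D : Set (Euc d)) : Prop :=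
  ∃ f : Euc d ≃ᵢ Euc d, D = f '' K

def PairwiseDisjointInteriors {d : ℕ} (P : Set (Set (Euc d))) : Prop :=
  P.Pairwise fun D E => interior D ∩ interior E = ∅

/-- A packing of the body `K`: a collection of isometric copies of `K`
with pairwise disjoint interiors. -/
def IsPacking {d : ℕ} (K : Set (Euc d)) (P : Set (Set (Euc d))) : Prop :=
  (∀ D ∈ P, IsIsomCopy K D) ∧ PairwiseDisjointInteriors P

/-- Translate every element of a collection by the vector `v`. -/
def translatePacking {d : ℕ} (v : Euc d) (P : Set (Set (Euc d))) : Set (Set (Euc d)) :=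
  (fun D => (fun x => x + v) '' D) '' P

/-- The fraction of the ball `B(p,r)` covered by the collection `P`
(the sum over elements of `P` of the volume of the intersection, divided
by the volume of the ball). -/
def ballFrac {d : ℕ} (P : Set (Set (Euc d))) (p : Euc d) (r : ℝ) : ℝ :=
  ((∑' D : P, volume ((D : Set (Euc d)) ∩ ball p r)) / volume (ball p r)).toReal

/-- `P` has density `δ`. -/
def HasDensity {d : ℕ} (P : Set (Set (Euc d))) (δ : ℝ) : Prop :=
  ∀ p : Euc d, Tendsto (fun r => ballFrac P p r) atTop (nhds δ)

/-- `P` has density `δ` uniformly in the center point. -/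
def HasUniformDensity {d : ℕ} (P : Set (Set (Euc d))) (δ : ℝ) : Prop :=
  TendstoUniformly (fun r (p : Euc d) => ballFrac P p r) (fun _ => δ) atTop

/-- The packing density of the body `K`. -/
def packingDensity {d : ℕ} (K : Set (Euc d)) : ℝ :=
  sSup {δ : ℝ | ∃ P, IsPacking K P ∧ HasDensity P δ}

/-- Modified Hausdorff distance at most `ε` between two collections: there is a
relation between elements, related elements are at Hausdorff distance at most `ε`,
and every element meeting the ball `B(0,1/ε)` is related to a unique element on
the other side. -/
def PackingClose {d : ℕ} (ε : ℝ) (P Q : Set (Set (Euc d))) : Prop :=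
  ∃ R : Set (Euc d) → Set (Euc d) → Prop,
    (∀ A B, R A B → A ∈ P ∧ B ∈ Q ∧ Metric.hausdorffDist A B ≤ ε) ∧
    (∀ A ∈ P, (A ∩ ball (0 : Euc d) (1 / ε)).Nonempty → ∃! B, R A B) ∧
    (∀ B ∈ Q, (B ∩ ball (0 : Euc d) (1 / ε)).Nonempty → ∃! A, R A B)

/-- Convergence of a sequence of collections to `Q` in the modified Hausdorff topology. -/
def PackingTendsto {d : ℕ} (Ps : ℕ → Set (Set (Euc d))) (Q : Set (Set (Euc d))) : Prop :=
  ∀ ε : ℝ, 0 < ε → ∀ᶠ n in atTop, PackingClose ε (Ps n) Q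

/-- `A ≽_L B` : some sequence of translates of `B` converges to `A`. -/
def IsLimitOf {d : ℕ} (A B : Set (Set (Euc d))) : Prop :=
  ∃ v : ℕ → Euc d, PackingTendsto (fun n => translatePacking (v n) B) A

/-- A packing of `K` is uniformly recurrent if it is maximal with respect to `≽_L`
among packings of `K`. -/
def UniformlyRecurrent {d : ℕ} (K : Set (Euc d)) (A : Set (Set (Euc d))) : Prop :=
  ∀ B, IsPacking K B → IsLimitOf B A → IsLimitOf A B

/-- `P` is `n`-saturated: one cannot remove `n-1` of its elements and replace them
by `n` isometric copies of `K` so that the result is still a packing. -/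
def Saturated {d : ℕ} (K : Set (Euc d)) (n : ℕ) (P : Set (Set (Euc d))) : Prop :=
  ¬ ∃ F G : Finset (Set (Euc d)), ↑F ⊆ P ∧ F.card = n - 1 ∧ G.card = n ∧
      Disjoint (↑G : Set (Set (Euc d))) (P \ ↑F) ∧
      IsPacking K ((P \ ↑F) ∪ ↑G)

def CompletelySaturated {d : ℕ} (K : Set (Euc d)) (P : Set (Set (Euc d))) : Prop :=
  ∀ n : ℕ, 1 ≤ n → Saturated K n P

/-- `K` (strictly) self-nests: for every `ε > 0` some isometric copy of `K` lies in
the interior of `(1+ε)K`. -/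
def SelfNests {d : ℕ} (K : Set (Euc d)) : Prop :=
  ∀ ε : ℝ, 0 < ε → ∃ f : Euc d ≃ᵢ Euc d, f '' K ⊆ interior ((1 + ε) • K)

/-- A single connected replacement: `A` is obtained from `B` by replacing `k < n`
copies of `K` by `k+1` copies so that the union of the `2k+1` copies involved is
connected. -/
def ConnStep {d : ℕ} (K : Set (Euc d)) (n : ℕ) (B A : Set (Set (Euc d))) : Prop :=
  ∃ (k : ℕ) (F G : Finset (Set (Euc d))), k < n ∧ ↑F ⊆ B ∧ F.card = k ∧ G.card = k + 1 ∧
    Disjoint (↑G : Set (Set (Euc d))) (B \ ↑F) ∧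
    A = (B \ ↑F) ∪ ↑G ∧ IsPacking K A ∧
    IsConnected (⋃ D ∈ (↑F ∪ ↑G : Set (Set (Euc d))), D)

/-- `A ≽_{C,n} B` : `A` is obtained from `B` by finitely many connected replacements. -/
def ConnGE {d : ℕ} (K : Set (Euc d)) (n : ℕ) (A B : Set (Set (Euc d))) : Prop :=
  Relation.ReflTransGen (ConnStep K n) B A

/-- The density function of the convolution `μ * χ_P` evaluated at the point `p`:
`∑_{D ∈ P} μ {x | p - x ∈ D}`. -/
def diffuse {d : ℕ} (μ : Measure (Euc d)) (P : Set (Set (Euc d))) (p : Euc d) : ℝ≥0∞ :=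
  ∑' D : P, μ {x : Euc d | p - x ∈ (D : Set (Euc d))}

/-- The value of the measure `χ_P * μ` on the (Borel) set `R`. -/
def diffuseOn {d : ℕ} (μ : Measure (Euc d)) (P : Set (Set (Euc d))) (R : Set (Euc d)) : ℝ≥0∞ :=
  ∫⁻ p in R, diffuse μ P p

/-- The measure with density `(n/(n+1))^{|x|/(2n-1)}` with respect to Lebesgue measure. -/
def kupMeasure (d n : ℕ) : Measure (Euc d) :=
  volume.withDensity fun x =>
    ENNReal.ofReal (((n : ℝ) / (n + 1)) ^ (‖x‖ / (2 * (n : ℝ) - 1)))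

/-- A generic packing: a collection of bodies with pairwise disjoint interiors. -/
def IsGenPacking {d : ℕ} (P : Set (Set (Euc d))) : Prop :=
  (∀ D ∈ P, IsBody D) ∧ PairwiseDisjointInteriors P

/-- `A ≽_μ B` : `μ * χ_A ≥ μ * χ_B` everywhere. -/
def MuDom {d : ℕ} (μ : Measure (Euc d)) (A B : Set (Set (Euc d))) : Prop :=
  ∀ p : Euc d, diffuse μ B p ≤ diffuse μ A p

/-- `A ≽_D B` : `A` diffusively dominates `B`. -/
def DiffDom {d : ℕ} (A B : Set (Set (Euc d))) : Prop :=
  ∃ μ : Measure (Euc d), IsFiniteMeasure μ ∧ MuDom μ A B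

/-- `P` is weakly recurrent if it is the limit of a sequence of uniformly
recurrent packings of `K`. -/
def WeaklyRecurrent {d : ℕ} (K : Set (Euc d)) (P : Set (Set (Euc d))) : Prop :=
  ∃ Bs : ℕ → Set (Set (Euc d)),
    (∀ i, IsPacking K (Bs i) ∧ UniformlyRecurrent K (Bs i)) ∧ PackingTendsto Bs P

section Copies

variable {d : ℕ} {K D : Set (Euc d)}

theorem measurePreserving_isometryEquiv (f : Euc d ≃ᵢ Euc d) :
    MeasurePreserving f volume volume := by
  have h := (measurePreserving_add_right (volume : Measure (Euc d)) (f 0)).comp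
    (LinearIsometryEquiv.measurePreserving f.toRealLinearIsometryEquiv)
  have hf : ⇑f = (fun x => x + f 0) ∘ f.toRealLinearIsometryEquiv := by
    funext x
    simp [IsometryEquiv.toRealLinearIsometryEquiv_apply]
  rwa [hf]

theorem volume_isometryEquiv_image (f : Euc d ≃ᵢ Euc d) (s : Set (Euc d)) :
    volume (f '' s) = volume s := by
  have h := (measurePreserving_isometryEquiv f.symm).measure_preimage_equiv
    (f := f.symm.toHomeomorph.toMeasurableEquiv) s
  rw [← h]
  congr 1
  exact f.toEquiv.image_eq_preimage_symm s

theorem interior_isometryEquiv_image (f : Euc d ≃ᵢ Euc d) (s : Set (Euc d)) :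
    interior (f '' s) = f '' interior s :=
  (f.toHomeomorph.image_interior s).symm

theorem IsIsomCopy.isCompact (hK : IsCompact K) (hD : IsIsomCopy K D) : IsCompact D := by
  obtain ⟨f, rfl⟩ := hD
  exact hK.image f.continuous

theorem IsIsomCopy.nonempty (hK : K.Nonempty) (hD : IsIsomCopy K D) : D.Nonempty := by
  obtain ⟨f, rfl⟩ := hD
  exact hK.image f

theorem IsIsomCopy.volume_eq (hD : IsIsomCopy K D) : volume D = volume K := by
  obtain ⟨f, rfl⟩ := hD
  exact volume_isometryEquiv_image f K

theorem IsIsomCopy.volume_interior_eq (hD : IsIsomCopy K D) :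
    volume (interior D) = volume (interior K) := by
  obtain ⟨f, rfl⟩ := hD
  rw [interior_isometryEquiv_image, volume_isometryEquiv_image]

theorem IsIsomCopy.translate (hD : IsIsomCopy K D) (v : Euc d) :
    IsIsomCopy K ((fun x => x + v) '' D) := by
  obtain ⟨f, rfl⟩ := hD
  refine ⟨f.trans (IsometryEquiv.addRight v), ?_⟩
  rw [Set.image_image]
  rfl

theorem IsBody.interior_nonempty (hK : IsBody K) (hne : K.Nonempty) : (interior K).Nonempty := by
  rw [hK.2] at hne
  exact closure_nonempty_iff.1 hne

theorem IsIsomCopy.subset_ball (hK : IsCompact K) (hD : IsIsomCopy K D) {x : Euc d} (hx : x ∈ D) :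
    D ⊆ ball x (diam K + 1) := by
  obtain ⟨f, rfl⟩ := hD
  intro y hy
  have h := dist_le_diam_of_mem (hK.image f.continuous).isBounded hy hx
  rw [f.isometry.diam_image] at h
  exact mem_ball.2 (by linarith)

theorem IsIsomCopy.subset_ball_of_meets (hK : IsCompact K) (hD : IsIsomCopy K D) {x : Euc d}
    {r s : ℝ} (hrs : r + (diam K + 1) ≤ s) (h : (D ∩ ball x r).Nonempty) : D ⊆ ball x s := by
  obtain ⟨y, hyD, hy⟩ := h
  refine (hD.subset_ball hK hyD).trans (ball_subset_ball' ?_)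
  linarith [mem_ball.1 hy]

theorem IsIsomCopy.hausdorffEDist_ne_top {E : Set (Euc d)} (hK : IsCompact K) (hne : K.Nonempty)
    (hD : IsIsomCopy K D) (hE : IsIsomCopy K E) : hausdorffEDist D E ≠ ⊤ :=
  hausdorffEDist_ne_top_of_nonempty_of_bounded (hD.nonempty hne) (hE.nonempty hne)
    (hD.isCompact hK).isBounded (hE.isCompact hK).isBounded

end Copies

section Limits

variable {d : ℕ} {K D : Set (Euc d)} {ι : Type*}

theorem exists_ultrafilter_tendsto_of_bounded (u : Ultrafilter ι) {g : ι → Euc d} {c : Euc d}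
    {R : ℝ} (h : ∀ᶠ n in (u : Filter ι), dist (g n) c ≤ R) :
    ∃ y, Tendsto g u (nhds y) := by
  obtain ⟨y, -, hy⟩ := (isCompact_closedBall c R).ultrafilter_le_nhds (u.map g)
    (le_principal_iff.2 h)
  exact ⟨y, hy⟩

theorem exists_ultrafilter_limit_isometryEquiv (u : Ultrafilter ι) (f : ι → Euc d ≃ᵢ Euc d)
    {a c : Euc d} {R : ℝ} (h : ∀ᶠ n in (u : Filter ι), dist (f n a) c ≤ R) :
    ∃ F : Euc d ≃ᵢ Euc d, (∀ x, Tendsto (fun n => f n x) u (nhds (F x))) ∧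
      ∀ x, Tendsto (fun n => (f n).symm x) u (nhds (F.symm x)) := by
  have h₁ : ∀ x, ∃ y, Tendsto (fun n => f n x) u (nhds y) := fun x =>
    exists_ultrafilter_tendsto_of_bounded u (c := c) (R := dist x a + R) <| h.mono fun n hn => by
      have := dist_triangle (f n x) (f n a) c
      rw [(f n).dist_eq] at this
      linarith
  have h₂ : ∀ x, ∃ y, Tendsto (fun n => (f n).symm x) u (nhds y) := fun x =>
    exists_ultrafilter_tendsto_of_bounded u (c := a) (R := dist x c + R) <| h.mono fun n hn => by
      have h := (f n).dist_eq ((f n).symm x) a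
      rw [IsometryEquiv.apply_symm_apply] at h
      rw [← h]
      have := dist_triangle_right x (f n a) c
      linarith
  choose F hF using h₁
  choose G hG using h₂
  have hiso : Isometry F := Isometry.of_dist_eq fun x y =>
    tendsto_nhds_unique ((hF x).dist (hF y)) (by simp [IsometryEquiv.dist_eq])
  have hFG : ∀ x, F (G x) = x := fun x => by
    refine tendsto_nhds_unique (hF (G x)) (tendsto_iff_dist_tendsto_zero.2 ?_)
    have := (hG x).dist (tendsto_const_nhds (x := G x))
    rw [dist_self] at this
    refine this.congr fun n => ?_
    rw [← (f n).dist_eq, IsometryEquiv.apply_symm_apply, dist_comm]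
  refine ⟨IsometryEquiv.mk' F G hFG hiso, hF, fun x => ?_⟩
  exact hG x

theorem eventually_forall_dist_le_of_tendsto (hK : IsCompact K) (u : Ultrafilter ι)
    {f : ι → Euc d ≃ᵢ Euc d} {F : Euc d ≃ᵢ Euc d}
    (h : ∀ x, Tendsto (fun n => f n x) u (nhds (F x))) {ε : ℝ} (hε : 0 < ε) :
    ∀ᶠ n in (u : Filter ι), ∀ x ∈ K, dist (f n x) (F x) ≤ ε := by
  by_contra hcon
  rw [← Ultrafilter.eventually_not] at hcon
  push Not at hcon
  have hK' : K.Nonempty := by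
    obtain ⟨n, x, hx, -⟩ := hcon.exists
    exact ⟨x, hx⟩
  have : ∀ n, ∃ x, x ∈ K ∧ ((∃ x ∈ K, ε < dist (f n x) (F x)) → ε < dist (f n x) (F x)) := by
    intro n
    by_cases hn : ∃ x ∈ K, ε < dist (f n x) (F x)
    · obtain ⟨x, hx, h⟩ := hn
      exact ⟨x, hx, fun _ => h⟩
    · exact ⟨hK'.some, hK'.some_mem, fun h => absurd h hn⟩
  choose k hkK hk using this
  obtain ⟨y, -, hy⟩ := hK.ultrafilter_le_nhds (u.map k)
    (le_principal_iff.2 (Eventually.of_forall hkK : ∀ᶠ n in (u : Filter ι), k n ∈ K))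
  have hy : Tendsto k u (nhds y) := hy
  have h₁ : ∀ᶠ n in (u : Filter ι), dist (k n) y < ε / 4 :=
    hy.eventually (ball_mem_nhds y (by positivity))
  have h₂ : ∀ᶠ n in (u : Filter ι), dist (f n y) (F y) < ε / 4 :=
    (h y).eventually (ball_mem_nhds _ (by positivity))
  obtain ⟨n, hn, hn₁, hn₂⟩ := (hcon.and (h₁.and h₂)).exists
  have h₃ := hk n hn
  have h₄ := dist_triangle4 (f n (k n)) (f n y) (F y) (F (k n))
  rw [(f n).dist_eq, F.dist_eq, dist_comm y] at h₄
  linarith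

theorem eventually_hausdorffDist_le_of_tendsto (hK : IsCompact K) (u : Ultrafilter ι)
    {f : ι → Euc d ≃ᵢ Euc d} {F : Euc d ≃ᵢ Euc d}
    (h : ∀ x, Tendsto (fun n => f n x) u (nhds (F x))) {ε : ℝ} (hε : 0 < ε) :
    ∀ᶠ n in (u : Filter ι), hausdorffDist (f n '' K) (F '' K) ≤ ε := by
  filter_upwards [eventually_forall_dist_le_of_tendsto hK u h hε] with n hn
  refine hausdorffDist_le_of_mem_dist hε.le ?_ ?_
  · rintro _ ⟨x, hx, rfl⟩
    exact ⟨F x, ⟨x, hx, rfl⟩, hn x hx⟩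
  · rintro _ ⟨x, hx, rfl⟩
    exact ⟨f n x, ⟨x, hx, rfl⟩, by rw [dist_comm]; exact hn x hx⟩

/-- A point of the interior of a limit copy is eventually interior to the converging copies. -/
theorem eventually_mem_interior_of_tendsto (u : Ultrafilter ι)
    {f : ι → Euc d ≃ᵢ Euc d} {F : Euc d ≃ᵢ Euc d}
    (h : ∀ x, Tendsto (fun n => (f n).symm x) u (nhds (F.symm x))) {x : Euc d}
    (hx : x ∈ interior (F '' K)) :
    ∀ᶠ n in (u : Filter ι), x ∈ interior (f n '' K) := by
  rw [interior_isometryEquiv_image] at hx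
  obtain ⟨y, hy, rfl⟩ := hx
  have h₁ : ∀ᶠ n in (u : Filter ι), (f n).symm (F y) ∈ interior K := by
    refine (h (F y)).eventually ?_
    rw [IsometryEquiv.symm_apply_apply]
    exact isOpen_interior.mem_nhds hy
  filter_upwards [h₁] with n hn
  rw [interior_isometryEquiv_image]
  exact ⟨_, hn, (f n).apply_symm_apply _⟩

/-- Two isometric copies of a body that are close in the Hausdorff distance overlap. -/
theorem exists_pos_interior_inter_nonempty_of_hausdorffDist_lt (hK : IsBody K)
    (hne : K.Nonempty) :
    ∃ ρ : ℝ, 0 < ρ ∧ ∀ D E : Set (Euc d), IsIsomCopy K D → IsIsomCopy K E →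
      hausdorffDist D E < ρ → (interior D ∩ interior E).Nonempty := by
  by_contra hcon
  push Not at hcon
  have hpos : ∀ n : ℕ, (0 : ℝ) < 1 / ((n : ℝ) + 1) := fun n => Nat.one_div_pos_of_nat
  have key : ∀ n : ℕ, ∃ f : Euc d ≃ᵢ Euc d, hausdorffDist K (f '' K) < 1 / ((n : ℝ) + 1) ∧
      interior K ∩ interior (f '' K) = ∅ := by
    intro n
    obtain ⟨_, _, ⟨f, rfl⟩, ⟨g, rfl⟩, hd, hi⟩ := hcon _ (hpos n)
    refine ⟨g.trans f.symm, ?_, ?_⟩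
    · have : g '' K = f '' ((g.trans f.symm) '' K) := by
        rw [Set.image_image]
        exact Set.image_congr fun x _ => (f.apply_symm_apply (g x)).symm
      rwa [this, hausdorffDist_image f.isometry] at hd
    · rw [interior_isometryEquiv_image, interior_isometryEquiv_image] at hi
      rw [interior_isometryEquiv_image, ← Set.not_nonempty_iff_eq_empty]
      rintro ⟨x, hx, y, hy, hyx⟩
      rw [← Set.not_nonempty_iff_eq_empty] at hi
      refine hi ⟨f x, ⟨x, hx, rfl⟩, y, hy, ?_⟩
      rw [← hyx]
      simp
  choose f hfd hfi using key
  have hcopy : ∀ g : Euc d ≃ᵢ Euc d, IsIsomCopy K (g '' K) := fun g => ⟨g, rfl⟩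
  have hKK : IsIsomCopy K K := ⟨IsometryEquiv.refl _, (Set.image_id K).symm⟩
  obtain ⟨a, ha⟩ := hne
  have hne : K.Nonempty := ⟨a, ha⟩
  let u : Ultrafilter ℕ := Filter.hyperfilter ℕ
  have hu : (u : Filter ℕ) ≤ atTop := Nat.hyperfilter_le_atTop
  have hb : ∀ᶠ n in (u : Filter ℕ), dist (f n a) a ≤ diam K + 1 := by
    refine Eventually.of_forall fun n => ?_
    obtain ⟨y, hy, hay⟩ := exists_dist_lt_of_hausdorffDist_lt' (Set.mem_image_of_mem (f n) ha)
      (hfd n) (hKK.hausdorffEDist_ne_top hK.1 hne (hcopy _))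
    have h₁ := dist_le_diam_of_mem hK.1.isBounded hy ha
    have h₂ := dist_triangle (f n a) y a
    have h₃ : 1 / ((n : ℝ) + 1) ≤ 1 := by
      rw [div_le_one (by positivity)]
      linarith [(Nat.cast_nonneg n : (0 : ℝ) ≤ n)]
    rw [dist_comm y] at hay
    linarith
  obtain ⟨F, hF, hF'⟩ := exists_ultrafilter_limit_isometryEquiv u f hb
  have hFK : K = F '' K := by
    refine (IsClosed.hausdorffDist_zero_iff_eq hK.1.isClosed ((hcopy F).isCompact hK.1).isClosed
      (hKK.hausdorffEDist_ne_top hK.1 hne (hcopy F))).1 (le_antisymm ?_ hausdorffDist_nonneg)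
    refine le_of_forall_pos_le_add fun ε hε => ?_
    have h₁ : ∀ᶠ n : ℕ in (u : Filter ℕ), 1 / ((n : ℝ) + 1) < ε / 2 :=
      (tendsto_one_div_add_atTop_nhds_zero_nat.eventually_lt_const (half_pos hε)).filter_mono hu
    obtain ⟨n, hn, hn'⟩ :=
      ((eventually_hausdorffDist_le_of_tendsto hK.1 u hF (half_pos hε)).and h₁).exists
    have h₂ := hausdorffDist_triangle (s := K) (t := f n '' K) (u := F '' K)
      (hKK.hausdorffEDist_ne_top hK.1 hne (hcopy _))
    linarith [hfd n]
  obtain ⟨x, hx⟩ := hK.interior_nonempty hne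
  obtain ⟨n, hn⟩ := (eventually_mem_interior_of_tendsto (K := K) u hF' (hFK ▸ hx)).exists
  exact (hfi n).subset ⟨hx, hn⟩

end Limits

section Counting

variable {d : ℕ} {K : Set (Euc d)} {P Q : Set (Set (Euc d))}

/-- The elements of `P` meeting the ball `B(x,r)`. -/
def touching (P : Set (Set (Euc d))) (x : Euc d) (r : ℝ) : Set (Set (Euc d)) :=
  {D ∈ P | (D ∩ ball x r).Nonempty}

/-- The elements of `P` contained in the ball `B(x,r)`. -/
def inside (P : Set (Set (Euc d))) (x : Euc d) (r : ℝ) : Set (Set (Euc d)) :=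
  {D ∈ P | D ⊆ ball x r}

theorem IsPacking.subset (hQ : IsPacking K Q) (h : P ⊆ Q) : IsPacking K P :=
  ⟨fun D hD => hQ.1 D (h hD), hQ.2.mono h⟩

theorem IsPacking.translate (hP : IsPacking K P) (v : Euc d) :
    IsPacking K (translatePacking v P) := by
  refine ⟨?_, ?_⟩
  · rintro _ ⟨D, hD, rfl⟩
    exact (hP.1 D hD).translate v
  · rintro _ ⟨D, hD, rfl⟩ _ ⟨E, hE, rfl⟩ hne
    have h := hP.2 hD hE (fun h => hne (by rw [h]))
    have hi : ∀ s : Set (Euc d), interior ((fun x => x + v) '' s) = (fun x => x + v) '' interior s :=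
      interior_isometryEquiv_image (IsometryEquiv.addRight v)
    change interior ((fun x => x + v) '' D) ∩ interior ((fun x => x + v) '' E) = ∅
    rw [hi, hi, ← Set.image_inter (add_left_injective v), h, Set.image_empty]

theorem volume_interior_pos (hK : IsBody K) (hne : K.Nonempty) : 0 < volume (interior K) :=
  isOpen_interior.measure_pos volume (hK.interior_nonempty hne)

theorem IsPacking.card_mul_volume_interior_le {F : Finset (Set (Euc d))}
    (hF : IsPacking K (F : Set (Set (Euc d)))) {A : Set (Euc d)} (hA : ∀ D ∈ F, D ⊆ A) :
    (F.card : ℝ≥0∞) * volume (interior K) ≤ volume A := by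
  have h := measure_biUnion_finset (μ := volume) (s := F) (f := fun D : Set (Euc d) => interior D)
    (fun D hD E hE hne => Set.disjoint_iff_inter_eq_empty.2 (hF.2 hD hE hne))
    (fun D _ => isOpen_interior.measurableSet)
  rw [Finset.sum_congr rfl fun D hD => (hF.1 D hD).volume_interior_eq, Finset.sum_const,
    nsmul_eq_mul] at h
  rw [← h]
  exact measure_mono (Set.iUnion₂_subset fun D hD => interior_subset.trans (hA D hD))

theorem IsPacking.finite_of_subset (hK : IsBody K) (hne : K.Nonempty) (hP : IsPacking K P)
    {A : Set (Euc d)} (hA : ∀ D ∈ P, D ⊆ A) (hvol : volume A ≠ ⊤) : P.Finite := by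
  by_contra hinf
  have hv := volume_interior_pos hK hne
  obtain ⟨n, hn⟩ := ENNReal.exists_nat_mul_gt hv.ne' hvol
  obtain ⟨F, hFP, hFn⟩ := Set.Infinite.exists_subset_card_eq hinf n
  have := (hP.subset hFP).card_mul_volume_interior_le fun D hD => hA D (hFP hD)
  rw [hFn] at this
  exact absurd hn (not_lt.2 this)

theorem IsPacking.touching_subset_ball (hK : IsBody K) (hP : IsPacking K P) {x : Euc d} {r s : ℝ}
    (hrs : r + (diam K + 1) ≤ s) {D : Set (Euc d)} (hD : D ∈ touching P x r) : D ⊆ ball x s :=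
  (hP.1 D hD.1).subset_ball_of_meets hK.1 hrs hD.2

theorem IsPacking.finite_touching (hK : IsBody K) (hne : K.Nonempty) (hP : IsPacking K P)
    (x : Euc d) (r : ℝ) : (touching P x r).Finite :=
  (hP.subset (fun _ h => h.1)).finite_of_subset hK hne
    (fun _ hD => hP.touching_subset_ball hK le_rfl hD) measure_ball_lt_top.ne

theorem inside_subset_touching (hne : K.Nonempty) (hP : IsPacking K P) (x : Euc d) (r : ℝ) :
    inside P x r ⊆ touching P x r := by
  rintro D ⟨hD, hsub⟩
  obtain ⟨y, hy⟩ := (hP.1 D hD).nonempty hne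
  exact ⟨hD, y, hy, hsub hy⟩

theorem IsPacking.touching_subset_inside (hK : IsBody K) (hP : IsPacking K P) {x : Euc d}
    {r s : ℝ} (hrs : r + (diam K + 1) ≤ s) : touching P x r ⊆ inside P x s :=
  fun _ hD => ⟨hD.1, hP.touching_subset_ball hK hrs hD⟩

theorem PackingClose.mono {ε ε' : ℝ} (hε : 0 < ε) (hle : ε ≤ ε') (h : PackingClose ε P Q) :
    PackingClose ε' P Q := by
  obtain ⟨R, h₁, h₂, h₃⟩ := h
  have hsub : ball (0 : Euc d) (1 / ε') ⊆ ball 0 (1 / ε) :=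
    ball_subset_ball (one_div_le_one_div_of_le hε hle)
  exact ⟨R, fun A B hAB => ⟨(h₁ A B hAB).1, (h₁ A B hAB).2.1, (h₁ A B hAB).2.2.trans hle⟩,
    fun A hA hm => h₂ A hA (hm.mono (Set.inter_subset_inter_right _ hsub)),
    fun B hB hm => h₃ B hB (hm.mono (Set.inter_subset_inter_right _ hsub))⟩

theorem PackingClose.encard_touching_le (hK : IsBody K) (hne : K.Nonempty) (hP : IsPacking K P)
    (hQ : IsPacking K Q) {ε t s : ℝ} {x : Euc d} (ht : ε < t) (hs : ‖x‖ + s + t ≤ 1 / ε)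
    (ht0 : 0 < t) (h : PackingClose ε P Q) :
    (touching P x s).encard ≤ (touching Q x (s + t)).encard := by
  obtain ⟨R, h₁, h₂, h₃⟩ := h
  have hball : ball x (s + t) ⊆ ball (0 : Euc d) (1 / ε) :=
    ball_subset_ball' (by rw [dist_zero_right]; linarith)
  have hex : ∀ A ∈ touching P x s, ∃ B, R A B := fun A hA =>
    (h₂ A hA.1 (hA.2.mono (Set.inter_subset_inter_right _
      ((ball_subset_ball (by linarith)).trans hball)))).exists
  choose! g hg using hex
  have hmaps : Set.MapsTo g (touching P x s) (touching Q x (s + t)) := by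
    intro A hA
    obtain ⟨hAP, hBQ, hd⟩ := h₁ _ _ (hg A hA)
    obtain ⟨y, hyA, hyx⟩ := hA.2
    obtain ⟨z, hz, hyz⟩ := exists_dist_lt_of_hausdorffDist_lt hyA (hd.trans_lt ht)
      ((hP.1 A hAP).hausdorffEDist_ne_top hK.1 hne (hQ.1 _ hBQ))
    refine ⟨hBQ, z, hz, mem_ball.2 ?_⟩
    have := dist_triangle z y x
    rw [dist_comm z y] at this
    linarith [mem_ball.1 hyx]
  refine Set.encard_le_encard_of_injOn hmaps fun A hA A' hA' hAA' => ?_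
  have hB := hmaps hA
  refine (h₃ (g A) hB.1 (hB.2.mono (Set.inter_subset_inter_right _ hball))).unique (hg A hA) ?_
  rw [hAA']
  exact hg A' hA'

/-- Every sequence of packings of a body accumulates at some packing. -/
theorem exists_packing_ultrafilter_limit (hK : IsBody K) (hne : K.Nonempty) (u : Ultrafilter ℕ)
    {Ps : ℕ → Set (Set (Euc d))} (hPs : ∀ n, IsPacking K (Ps n)) :
    ∃ B, IsPacking K B ∧ ∀ ε : ℝ, 0 < ε → ∀ᶠ n in (u : Filter ℕ), PackingClose ε (Ps n) B := by
  obtain ⟨ρ, hρ, hsep⟩ := exists_pos_interior_inter_nonempty_of_hausdorffDist_lt hK hne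
  have hcopy : ∀ g : Euc d ≃ᵢ Euc d, IsIsomCopy K (g '' K) := fun g => ⟨g, rfl⟩
  let B : Set (Set (Euc d)) := {D | ∃ (f : ℕ → Euc d ≃ᵢ Euc d) (F : Euc d ≃ᵢ Euc d),
    D = F '' K ∧ (∀ᶠ n in (u : Filter ℕ), f n '' K ∈ Ps n) ∧
    (∀ x, Tendsto (fun n => f n x) u (nhds (F x))) ∧
    ∀ x, Tendsto (fun n => (f n).symm x) u (nhds (F.symm x))}
  have hB : IsPacking K B := by
    refine ⟨fun D ⟨f, F, hD, _⟩ => ⟨F, hD⟩, ?_⟩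
    rintro _ ⟨f, F, rfl, hfP, hf, hf'⟩ _ ⟨g, G, rfl, hgP, hg, hg'⟩ hne'
    by_contra hcon
    obtain ⟨x, hxF, hxG⟩ := Set.nonempty_iff_ne_empty.2 hcon
    have heq : ∀ᶠ n in (u : Filter ℕ), f n '' K = g n '' K := by
      filter_upwards [hfP, hgP, eventually_mem_interior_of_tendsto u hf' hxF,
        eventually_mem_interior_of_tendsto u hg' hxG] with n h₁ h₂ h₃ h₄
      by_contra hn
      exact ((hPs n).2 h₁ h₂ hn).subset ⟨h₃, h₄⟩
    refine hne' ((IsClosed.hausdorffDist_zero_iff_eq ((hcopy F).isCompact hK.1).isClosed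
      ((hcopy G).isCompact hK.1).isClosed
      ((hcopy F).hausdorffEDist_ne_top hK.1 hne (hcopy G))).1
      (le_antisymm ?_ hausdorffDist_nonneg))
    refine le_of_forall_pos_le_add fun ε hε => ?_
    obtain ⟨n, h₁, h₂, h₃⟩ := (heq.and
      ((eventually_hausdorffDist_le_of_tendsto hK.1 u hf (half_pos hε)).and
        (eventually_hausdorffDist_le_of_tendsto hK.1 u hg (half_pos hε)))).exists
    have h₄ := hausdorffDist_triangle (s := F '' K) (t := f n '' K) (u := G '' K)
      ((hcopy F).hausdorffEDist_ne_top hK.1 hne (hcopy _))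
    rw [hausdorffDist_comm] at h₂
    rw [← h₁] at h₃
    linarith
  refine ⟨B, hB, fun ε hε => ?_⟩
  obtain ⟨η, hη, hηε, hηρ⟩ : ∃ η : ℝ, 0 < η ∧ η ≤ ε ∧ η + η < ρ :=
    ⟨min ε (ρ / 3), by positivity, min_le_left _ _, by linarith [min_le_right ε (ρ / 3)]⟩
  have huniq : ∀ {Q : Set (Set (Euc d))}, IsPacking K Q → ∀ {C D E : Set (Euc d)},
      IsIsomCopy K C → D ∈ Q → E ∈ Q → hausdorffDist C D ≤ η → hausdorffDist C E ≤ η → D = E := by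
    intro Q hQ C D E hC hD hE hCD hCE
    by_contra hDE
    have h := hausdorffDist_triangle (s := D) (t := C) (u := E)
      ((hQ.1 D hD).hausdorffEDist_ne_top hK.1 hne hC)
    rw [hausdorffDist_comm] at hCD
    exact (hsep D E (hQ.1 D hD) (hQ.1 E hE) (by linarith)).ne_empty (hQ.2 hD hE hDE)
  have hforth : ∀ᶠ n in (u : Filter ℕ), ∀ A ∈ touching (Ps n) 0 (1 / ε),
      ∃ D ∈ B, hausdorffDist A D ≤ η := by
    by_contra hcon
    rw [← Ultrafilter.eventually_not] at hcon
    push Not at hcon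
    have hch : ∀ n, ∃ f : Euc d ≃ᵢ Euc d,
        (∃ A ∈ touching (Ps n) 0 (1 / ε), ∀ D ∈ B, η < hausdorffDist A D) →
        f '' K ∈ touching (Ps n) 0 (1 / ε) ∧ ∀ D ∈ B, η < hausdorffDist (f '' K) D := by
      intro n
      by_cases hn : ∃ A ∈ touching (Ps n) 0 (1 / ε), ∀ D ∈ B, η < hausdorffDist A D
      · obtain ⟨A, hA, hAB⟩ := hn
        obtain ⟨f, rfl⟩ := (hPs n).1 A hA.1
        exact ⟨f, fun _ => ⟨hA, hAB⟩⟩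
      · exact ⟨IsometryEquiv.refl _, fun h => absurd h hn⟩
    choose f hf using hch
    have hf' := hcon.mono hf
    obtain ⟨a, ha⟩ := hne
    obtain ⟨F, hF, hF'⟩ := exists_ultrafilter_limit_isometryEquiv u f (a := a) (c := 0)
      (R := 1 / ε + (diam K + 1)) <| hf'.mono fun n hn =>
        (mem_ball.1 ((hPs n).touching_subset_ball hK le_rfl hn.1 (Set.mem_image_of_mem _ ha))).le
    have hFB : F '' K ∈ B := ⟨f, F, rfl, hf'.mono fun n hn => hn.1.1, hF, hF'⟩
    obtain ⟨n, h₁, h₂⟩ :=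
      (hf'.and (eventually_hausdorffDist_le_of_tendsto hK.1 u hF hη)).exists
    exact absurd h₂ (not_le.2 (h₁.2 _ hFB))
  have hback : ∀ᶠ n in (u : Filter ℕ), ∀ D ∈ touching B 0 (1 / ε),
      ∃ A ∈ Ps n, hausdorffDist A D ≤ η := by
    rw [eventually_all_finite (hB.finite_touching hK hne _ _)]
    rintro _ ⟨⟨f, F, rfl, hfP, hF, -⟩, -⟩
    filter_upwards [hfP, eventually_hausdorffDist_le_of_tendsto hK.1 u hF hη] with n h₁ h₂
    exact ⟨_, h₁, h₂⟩
  filter_upwards [hforth, hback] with n h₁ h₂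
  refine ⟨fun A D => A ∈ Ps n ∧ D ∈ B ∧ hausdorffDist A D ≤ η,
    fun A D h => ⟨h.1, h.2.1, h.2.2.trans hηε⟩, fun A hA hm => ?_, fun D hD hm => ?_⟩
  · obtain ⟨D, hD, hAD⟩ := h₁ A ⟨hA, hm⟩
    exact ⟨D, ⟨hA, hD, hAD⟩, fun E hE => huniq hB ((hPs n).1 A hA) hE.2.1 hD hE.2.2 hAD⟩
  · obtain ⟨A, hA, hAD⟩ := h₂ D ⟨hD, hm⟩
    refine ⟨A, ⟨hA, hD, hAD⟩, fun E hE => huniq (hPs n) (hB.1 D hD) hE.1 hA ?_ ?_⟩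
    · rw [hausdorffDist_comm]; exact hE.2.2
    · rw [hausdorffDist_comm]; exact hAD

/-- A patch of a uniformly recurrent packing has nearby counterparts at bounded distance from
every point. -/
theorem UniformlyRecurrent.exists_forall_dist_le (hK : IsBody K) (hne : K.Nonempty)
    (hP : IsPacking K P) (hur : UniformlyRecurrent K P) (x₀ : Euc d) (s : ℝ) :
    ∃ L : ℝ, 0 ≤ L ∧ ∀ y : Euc d, ∃ x, dist x y ≤ L ∧
      (touching P x s).encard ≤ (touching P x₀ (s + 1)).encard := by
  by_contra hcon
  push Not at hcon
  choose y hy using fun n : ℕ => hcon (n : ℝ) n.cast_nonneg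
  let u : Ultrafilter ℕ := Filter.hyperfilter ℕ
  have hu : (u : Filter ℕ) ≤ atTop := Nat.hyperfilter_le_atTop
  obtain ⟨B, hB, hlim⟩ := exists_packing_ultrafilter_limit hK hne u
    (Ps := fun n => translatePacking (-y n) P) (fun n => hP.translate _)
  have hpos : ∀ k : ℕ, (0 : ℝ) < 1 / ((k : ℝ) + 1) := fun k => Nat.one_div_pos_of_nat
  choose φ hφ using fun k : ℕ => (hlim _ (hpos k)).exists
  have hBP : IsLimitOf B P := ⟨fun k => -y (φ k), fun ε hε => by
    filter_upwards [tendsto_one_div_add_atTop_nhds_zero_nat.eventually_lt_const hε] with k hk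
    exact (hφ k).mono (hpos k) hk.le⟩
  obtain ⟨v, hv⟩ := hur B hB hBP
  have hsmall : ∀ c : ℝ, ∃ ε : ℝ, 0 < ε ∧ ε < 1 / 2 ∧ c ≤ 1 / ε := fun c =>
    ⟨1 / (|c| + 3), by positivity,
      one_div_lt_one_div_of_lt (by norm_num) (by linarith [abs_nonneg c]), by
      rw [one_div_one_div]; linarith [le_abs_self c]⟩
  have htrans : ∀ (Q : Set (Set (Euc d))) (w z : Euc d) (r : ℝ),
      (touching (translatePacking w Q) (z + w) r).encard = (touching Q z r).encard := by
    intro Q w z r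
    have : touching (translatePacking w Q) (z + w) r
        = (fun D => (fun x => x + w) '' D) '' touching Q z r := by
      ext E
      constructor
      · rintro ⟨⟨D, hD, rfl⟩, _, ⟨p, hp, rfl⟩, hpz⟩
        exact ⟨D, ⟨hD, p, hp, by simpa using hpz⟩, rfl⟩
      · rintro ⟨D, ⟨hD, p, hp, hpz⟩, rfl⟩
        exact ⟨⟨D, hD, rfl⟩, p + w, ⟨p, hp, rfl⟩, by simpa using hpz⟩
    rw [this]
    exact (Set.image_injective.2 (add_left_injective w)).encard_image _
  obtain ⟨ε, hε, hε2, hεc⟩ := hsmall (‖x₀‖ + (s + 1 / 2) + 1 / 2)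
  obtain ⟨m, hm⟩ := (hv ε hε).exists
  have h₁ := hm.encard_touching_le hK hne (hB.translate _) hP hε2 hεc (by norm_num)
  have hx₀ : x₀ = (x₀ - v m) + v m := by abel
  rw [hx₀, htrans, ← hx₀] at h₁
  obtain ⟨ε', hε', hε2', hεc'⟩ := hsmall (‖x₀ - v m‖ + s + 1 / 2)
  obtain ⟨n, hn, hnn⟩ := ((hlim ε' hε').and
    ((tendsto_natCast_atTop_atTop.eventually_ge_atTop ‖x₀ - v m‖).filter_mono hu)).exists
  have h₂ := hn.encard_touching_le hK hne (hP.translate _) hB hε2' hεc' (by norm_num)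
  have hx : x₀ - v m = (x₀ - v m + y n) + -y n := by abel
  rw [hx, htrans, ← hx] at h₂
  have h₃ := hy n (x₀ - v m + y n) (by simpa using hnn)
  refine absurd (h₂.trans (h₁.trans_eq ?_)) (not_le.2 h₃)
  congr 2
  ring

end Counting

section BallVolume

variable {d : ℕ}

/-- The volume of a ball of radius `r` as a real number. -/
def ballVol (d : ℕ) (r : ℝ) : ℝ := (volume (ball (0 : Euc d) r)).toReal

theorem ballVol_nonneg (r : ℝ) : 0 ≤ ballVol d r := ENNReal.toReal_nonneg

theorem volume_ball_eq_ofReal (p : Euc d) (r : ℝ) :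
    volume (ball p r) = ENNReal.ofReal (ballVol d r) := by
  rw [ballVol, ENNReal.ofReal_toReal measure_ball_lt_top.ne, Measure.addHaar_ball_center]

theorem ballVol_pos {r : ℝ} (hr : 0 < r) : 0 < ballVol d r :=
  ENNReal.toReal_pos (measure_ball_pos _ _ hr).ne' measure_ball_lt_top.ne

theorem ballVol_eq {r : ℝ} (hr : 0 < r) : ballVol d r = r ^ d * ballVol d 1 := by
  rw [ballVol, Measure.addHaar_ball_of_pos _ _ hr, ENNReal.toReal_mul,
    ENNReal.toReal_ofReal (by positivity), finrank_euclideanSpace_fin, ballVol]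

theorem tendsto_ballVol_add_div (c : ℝ) :
    Tendsto (fun r => ballVol d (r + c) / ballVol d r) atTop (nhds 1) := by
  have h₁ : Tendsto (fun r : ℝ => (1 + c / r) ^ d) atTop (nhds 1) := by
    simpa using ((tendsto_const_nhds (x := c)).div_atTop tendsto_id).const_add 1 |>.pow d
  refine h₁.congr' ?_
  filter_upwards [eventually_gt_atTop 0, eventually_gt_atTop (-c)] with r hr hrc
  rw [ballVol_eq (by linarith : 0 < r + c), ballVol_eq hr,
    mul_div_mul_right _ _ (ballVol_pos one_pos).ne', ← div_pow, add_div, div_self hr.ne']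

end BallVolume

section CoverVolume

variable {d : ℕ} {K : Set (Euc d)} {P : Set (Set (Euc d))}

/-- The total volume of the intersections of elements of `P` with the ball `B(p,r)`. -/
def coverVol (P : Set (Set (Euc d))) (p : Euc d) (r : ℝ) : ℝ≥0∞ :=
  ∑' D : P, volume ((D : Set (Euc d)) ∩ ball p r)

theorem ballFrac_eq (P : Set (Set (Euc d))) (p : Euc d) (r : ℝ) :
    ballFrac P p r = (coverVol P p r).toReal / ballVol d r := by
  rw [ballFrac, ENNReal.toReal_div, coverVol, volume_ball_eq_ofReal,
    ENNReal.toReal_ofReal (ballVol_nonneg r)]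

theorem coverVol_le (hK : IsBody K) (hne : K.Nonempty) (hP : IsPacking K P) (p : Euc d) (r : ℝ) :
    coverVol P p r ≤ (touching P p r).ncard * volume K := by
  have hfin := hP.finite_touching hK hne p r
  rw [coverVol, tsum_subtype P fun D => volume (D ∩ ball p r),
    tsum_eq_sum (s := hfin.toFinset) fun D hD => ?_]
  · rw [Set.ncard_eq_toFinset_card _ hfin, ← nsmul_eq_mul]
    refine Finset.sum_le_card_nsmul _ _ _ fun D hD => ?_
    have hDP := ((Set.Finite.mem_toFinset _).1 hD).1
    rw [Set.indicator_of_mem hDP, ← (hP.1 D hDP).volume_eq]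
    exact measure_mono Set.inter_subset_left
  · rw [Set.indicator_apply_eq_zero]
    intro hDP
    have : D ∩ ball p r = ∅ := Set.not_nonempty_iff_eq_empty.1 fun h =>
      hD ((Set.Finite.mem_toFinset _).2 ⟨hDP, h⟩)
    rw [this, measure_empty]

theorem le_coverVol (hK : IsBody K) (hne : K.Nonempty) (hP : IsPacking K P) (p : Euc d) (r : ℝ) :
    (inside P p r).ncard * volume K ≤ coverVol P p r := by
  have hfin := (hP.finite_touching hK hne p r).subset (inside_subset_touching hne hP p r)
  rw [coverVol, tsum_subtype P fun D => volume (D ∩ ball p r)]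
  refine le_trans ?_ (ENNReal.sum_le_tsum hfin.toFinset)
  rw [Set.ncard_eq_toFinset_card _ hfin, ← nsmul_eq_mul]
  refine Finset.card_nsmul_le_sum _ _ _ fun D hD => ?_
  obtain ⟨hDP, hsub⟩ := (Set.Finite.mem_toFinset _).1 hD
  rw [Set.indicator_of_mem hDP, Set.inter_eq_left.2 hsub, (hP.1 D hDP).volume_eq]

theorem coverVol_toReal_le (hK : IsBody K) (hne : K.Nonempty) (hP : IsPacking K P) (p : Euc d)
    (r : ℝ) : (coverVol P p r).toReal ≤ (touching P p r).ncard * (volume K).toReal := by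
  have h := ENNReal.toReal_mono
    (ENNReal.mul_ne_top (ENNReal.natCast_ne_top _) hK.1.measure_lt_top.ne)
    (coverVol_le hK hne hP p r)
  rwa [ENNReal.toReal_mul, ENNReal.toReal_natCast] at h

theorem le_coverVol_toReal (hK : IsBody K) (hne : K.Nonempty) (hP : IsPacking K P) (p : Euc d)
    (r : ℝ) : (inside P p r).ncard * (volume K).toReal ≤ (coverVol P p r).toReal := by
  have h := ENNReal.toReal_mono (ne_top_of_le_ne_top
    (ENNReal.mul_ne_top (ENNReal.natCast_ne_top _) hK.1.measure_lt_top.ne)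
    (coverVol_le hK hne hP p r)) (le_coverVol hK hne hP p r)
  rwa [ENNReal.toReal_mul, ENNReal.toReal_natCast] at h

theorem volume_toReal_pos (hK : IsBody K) (hne : K.Nonempty) : 0 < (volume K).toReal :=
  ENNReal.toReal_pos
    ((volume_interior_pos hK hne).trans_le (measure_mono interior_subset)).ne'
    hK.1.measure_lt_top.ne

theorem ncard_touching_mul_le (hK : IsBody K) (hne : K.Nonempty) (hP : IsPacking K P) (p : Euc d)
    (r : ℝ) : (touching P p r).ncard * (volume (interior K)).toReal
      ≤ ballVol d (r + (diam K + 1)) := by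
  have hfin := hP.finite_touching hK hne p r
  have h := IsPacking.card_mul_volume_interior_le (F := hfin.toFinset)
    (A := ball p (r + (diam K + 1)))
    (hP.subset (by rw [Set.Finite.coe_toFinset]; exact fun _ h => h.1))
    (fun D hD => hP.touching_subset_ball hK le_rfl ((Set.Finite.mem_toFinset _).1 hD))
  rw [volume_ball_eq_ofReal, ← Set.ncard_eq_toFinset_card _ hfin] at h
  have h' := ENNReal.toReal_mono ENNReal.ofReal_ne_top h
  rwa [ENNReal.toReal_mul, ENNReal.toReal_natCast, ENNReal.toReal_ofReal (ballVol_nonneg _)] at h'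

theorem bddAbove_densities (hK : IsBody K) (hne : K.Nonempty) :
    BddAbove {δ : ℝ | ∃ P, IsPacking K P ∧ HasDensity P δ} := by
  have hv : 0 < (volume (interior K)).toReal :=
    ENNReal.toReal_pos (volume_interior_pos hK hne).ne'
      (measure_ne_top_of_subset interior_subset hK.1.measure_lt_top.ne)
  refine ⟨(volume K).toReal / (volume (interior K)).toReal * 1, ?_⟩
  rintro δ ⟨Q, hQ, hδ⟩
  refine le_of_tendsto_of_tendsto (hδ 0)
    ((tendsto_ballVol_add_div (d := d) (diam K + 1)).const_mul _) ?_
  filter_upwards [eventually_gt_atTop 0] with r hr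
  rw [ballFrac_eq, mul_div_assoc', div_le_div_iff_of_pos_right (ballVol_pos hr)]
  refine (coverVol_toReal_le hK hne hQ 0 r).trans ?_
  rw [div_mul_eq_mul_div, le_div_iff₀ hv, mul_right_comm, mul_comm (volume K).toReal]
  exact mul_le_mul_of_nonneg_right (ncard_touching_mul_le hK hne hQ 0 r) ENNReal.toReal_nonneg

end CoverVolume

section Boxes

variable {d : ℕ}

/-- The half-open cube with corner `c` and side `t`. -/
def box (c : Euc d) (t : ℝ) : Set (Euc d) := {x | ∀ i, c i ≤ x i ∧ x i < c i + t}

/-- The point of the lattice `t ℤ^d` with index `z`. -/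
def gridPoint (t : ℝ) (z : Fin d → ℤ) : Euc d := WithLp.toLp 2 fun i => t * z i

@[simp] theorem gridPoint_apply (t : ℝ) (z : Fin d → ℤ) (i : Fin d) :
    gridPoint t z i = t * z i := rfl

theorem box_eq_preimage (c : Euc d) (t : ℝ) :
    box c t = (WithLp.ofLp : Euc d → Fin d → ℝ) ⁻¹'
      Set.univ.pi fun i => Set.Ico (c i) (c i + t) := by
  ext x
  simp [box]

theorem measurableSet_box (c : Euc d) (t : ℝ) : MeasurableSet (box c t) := by
  rw [box_eq_preimage]
  exact (MeasurableSet.univ_pi fun i => measurableSet_Ico).preimage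
    (PiLp.volume_preserving_ofLp (Fin d)).measurable

theorem volume_box (c : Euc d) {t : ℝ} (ht : 0 ≤ t) : volume (box c t) = ENNReal.ofReal (t ^ d) := by
  rw [box_eq_preimage, (PiLp.volume_preserving_ofLp (Fin d)).measure_preimage
    (MeasurableSet.univ_pi fun i => measurableSet_Ico).nullMeasurableSet, Real.volume_pi_Ico]
  simp [ENNReal.ofReal_pow ht]

theorem dist_le_of_abs_le {x y : Euc d} {t : ℝ} (h : ∀ i, |x i - y i| ≤ t) :
    dist x y ≤ √(d * t ^ 2) := by
  rw [EuclideanSpace.dist_eq]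
  refine Real.sqrt_le_sqrt ?_
  have h' : ∑ i, dist (x i) (y i) ^ 2 ≤ ∑ _i : Fin d, t ^ 2 :=
    Finset.sum_le_sum fun i _ => by
      rw [Real.dist_eq]
      exact pow_le_pow_left₀ (abs_nonneg _) (h i) 2
  simpa using h'

theorem dist_le_of_mem_box {c x y : Euc d} {t : ℝ} (hx : x ∈ box c t) (hy : y ∈ box c t) :
    dist x y ≤ √(d * t ^ 2) :=
  dist_le_of_abs_le fun i => abs_le.2 ⟨by linarith [(hx i).1, (hy i).2],
    by linarith [(hx i).2, (hy i).1]⟩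

theorem abs_sub_le_dist (x y : Euc d) (i : Fin d) : |x i - y i| ≤ dist x y := by
  rw [dist_eq_norm]
  exact PiLp.norm_apply_le (x - y) i

theorem mem_box_add_gridPoint_iff {c x : Euc d} {t : ℝ} (ht : 0 < t) {z : Fin d → ℤ} :
    x ∈ box (c + gridPoint t z) t ↔ ∀ i, ⌊(x i - c i) / t⌋ = z i := by
  refine forall_congr' fun i => ?_
  rw [Int.floor_eq_iff, le_div_iff₀ ht, div_lt_iff₀ ht, PiLp.add_apply, gridPoint_apply]
  constructor <;> rintro ⟨h₁, h₂⟩ <;> constructor <;> linarith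

theorem disjoint_box {c : Euc d} {t : ℝ} (ht : 0 < t) {z w : Fin d → ℤ} (hzw : z ≠ w) :
    Disjoint (box (c + gridPoint t z) t) (box (c + gridPoint t w) t) := by
  refine Set.disjoint_left.2 fun x hx hy => hzw (funext fun i => ?_)
  rw [mem_box_add_gridPoint_iff ht] at hx hy
  rw [← hx i, ← hy i]

theorem iUnion_box (c : Euc d) {t : ℝ} (ht : 0 < t) :
    ⋃ z : Fin d → ℤ, box (c + gridPoint t z) t = Set.univ :=
  Set.eq_univ_of_forall fun x => Set.mem_iUnion.2
    ⟨fun i => ⌊(x i - c i) / t⌋, (mem_box_add_gridPoint_iff ht).2 fun _ => rfl⟩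

theorem tsum_volume_inter_box (c : Euc d) {t : ℝ} (ht : 0 < t) (A : Set (Euc d)) :
    ∑' z : Fin d → ℤ, volume (A ∩ box (c + gridPoint t z) t) = volume A := by
  have h := measure_iUnion (μ := volume.restrict A) (f := fun z => box (c + gridPoint t z) t)
    (fun z w hzw => disjoint_box ht hzw) (fun z => measurableSet_box _ _)
  rw [iUnion_box c ht, Measure.restrict_apply_univ] at h
  rw [h]
  refine tsum_congr fun z => ?_
  rw [Measure.restrict_apply (measurableSet_box _ _), Set.inter_comm]

theorem add_mem_box_iff {c x v : Euc d} {t : ℝ} : x + v ∈ box (c + v) t ↔ x ∈ box c t := by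
  refine forall_congr' fun i => ?_
  simp only [PiLp.add_apply]
  constructor <;> rintro ⟨h₁, h₂⟩ <;> constructor <;> linarith

end Boxes

section Periodization

variable {d : ℕ} {K : Set (Euc d)}

/-- The periodic collection with period lattice `t ℤ^d` generated by `F`. -/
def periodization (t : ℝ) (F : Set (Set (Euc d))) : Set (Set (Euc d)) :=
  ⋃ z : Fin d → ℤ, translatePacking (gridPoint t z) F

theorem image_subset_box_add {D : Set (Euc d)} {c v : Euc d} {t : ℝ} (hD : D ⊆ box c t) :
    (fun x => x + v) '' D ⊆ box (c + v) t := by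
  rintro _ ⟨x, hx, rfl⟩
  exact add_mem_box_iff.2 (hD hx)

theorem isPacking_periodization {t : ℝ} (ht : 0 < t) {c : Euc d} {F : Set (Set (Euc d))}
    (hF : IsPacking K F) (hFc : ∀ D ∈ F, D ⊆ box c t) : IsPacking K (periodization t F) := by
  refine ⟨fun D hD => ?_, fun D hD E hE hne => ?_⟩
  · obtain ⟨z, hz⟩ := Set.mem_iUnion.1 hD
    exact (hF.translate _).1 D hz
  · obtain ⟨z, hz⟩ := Set.mem_iUnion.1 hD
    obtain ⟨w, hw⟩ := Set.mem_iUnion.1 hE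
    rcases eq_or_ne z w with rfl | hzw
    · exact (hF.translate _).2 hz hw hne
    · obtain ⟨D', hD', rfl⟩ := hz
      obtain ⟨E', hE', rfl⟩ := hw
      exact Set.disjoint_iff_inter_eq_empty.1 ((disjoint_box ht hzw).mono
        (interior_subset.trans (image_subset_box_add (hFc D' hD')))
        (interior_subset.trans (image_subset_box_add (hFc E' hE'))))

theorem coverVol_periodization {t : ℝ} (ht : 0 < t) {c : Euc d} {F : Finset (Set (Euc d))}
    (hne : K.Nonempty) (hF : IsPacking K (F : Set (Set (Euc d))))
    (hFc : ∀ D ∈ F, D ⊆ box c t) (p : Euc d) (r : ℝ) :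
    coverVol (periodization t (F : Set (Set (Euc d)))) p r
      = ∑ D ∈ F, ∑' z : Fin d → ℤ, volume ((fun x => x + gridPoint t z) '' D ∩ ball p r) := by
  let j : F × (Fin d → ℤ) → periodization t (F : Set (Set (Euc d))) := fun q =>
    ⟨(fun x => x + gridPoint t q.2) '' q.1, Set.mem_iUnion.2 ⟨q.2, q.1, q.1.2, rfl⟩⟩
  have hj : Function.Bijective j := by
    refine ⟨?_, ?_⟩
    · rintro ⟨⟨D, hD⟩, z⟩ ⟨⟨E, hE⟩, w⟩ h
      have h : (fun x => x + gridPoint t z) '' D = (fun x => x + gridPoint t w) '' E :=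
        congrArg Subtype.val h
      have hzw : z = w := by
        by_contra hzw
        obtain ⟨x, hx⟩ := ((hF.1 D hD).nonempty hne).image fun x => x + gridPoint t z
        exact Set.disjoint_left.1 (disjoint_box ht hzw)
          (image_subset_box_add (hFc D hD) hx) (image_subset_box_add (hFc E hE) (h ▸ hx))
      subst hzw
      have hDE : D = E := Set.image_injective.2 (add_left_injective _) h
      subst hDE
      rfl
    · rintro ⟨_, hE⟩
      obtain ⟨z, D, hD, rfl⟩ := Set.mem_iUnion.1 hE
      exact ⟨⟨⟨D, hD⟩, z⟩, rfl⟩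
  rw [coverVol, ← (Equiv.ofBijective j hj).tsum_eq, ENNReal.tsum_prod', tsum_fintype]
  exact Finset.sum_coe_sort F fun D =>
    ∑' z : Fin d → ℤ, volume ((fun x => x + gridPoint t z) '' D ∩ ball p r)

/-- A finite packing inside a cube fills at most the proportion `packingDensity K` of it. -/
theorem card_mul_volume_le_packingDensity (hK : IsBody K) (hne : K.Nonempty) {t : ℝ} (ht : 0 < t)
    {c : Euc d} {F : Finset (Set (Euc d))} (hF : IsPacking K (F : Set (Set (Euc d))))
    (hFc : ∀ D ∈ F, D ⊆ box c t) :
    F.card * (volume K).toReal ≤ packingDensity K * t ^ d := by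
  have htd : 0 < t ^ d := pow_pos ht d
  rw [← div_le_iff₀ htd]
  refine le_csSup (bddAbove_densities hK hne)
    ⟨_, isPacking_periodization ht hF hFc, fun p => ?_⟩
  set ρ : ℝ := √(d * t ^ 2)
  have hVtop : volume K ≠ ⊤ := hK.1.measure_lt_top.ne
  set V : ℝ := (volume K).toReal with hV
  have himg : ∀ (D : Set (Euc d)) (z : Fin d → ℤ),
      volume ((fun x => x + gridPoint t z) '' D) = volume D := fun D z =>
    volume_isometryEquiv_image (IsometryEquiv.addRight (gridPoint t z)) D
  have hup : ∀ r, coverVol (periodization t (F : Set (Set (Euc d)))) p r * ENNReal.ofReal (t ^ d)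
      ≤ F.card * volume K * volume (ball p (r + ρ)) := by
    intro r
    rw [coverVol_periodization ht hne hF hFc, Finset.sum_mul, mul_assoc, ← nsmul_eq_mul]
    refine Finset.sum_le_card_nsmul _ _ _ fun D hD => ?_
    rw [← tsum_volume_inter_box c ht (ball p (r + ρ)), ← ENNReal.tsum_mul_right,
      ← ENNReal.tsum_mul_left]
    refine ENNReal.tsum_le_tsum fun z => ?_
    rcases Set.eq_empty_or_nonempty ((fun x => x + gridPoint t z) '' D ∩ ball p r) with h | ⟨x, hx⟩
    · rw [h, measure_empty, zero_mul]
      exact zero_le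
    · have hsub : box (c + gridPoint t z) t ⊆ ball p (r + ρ) := fun y hy => by
        have h₁ := dist_le_of_mem_box hy (image_subset_box_add (hFc D hD) hx.1)
        have h₂ := dist_triangle y x p
        exact mem_ball.2 (by linarith [mem_ball.1 hx.2])
      have hle : volume ((fun x => x + gridPoint t z) '' D ∩ ball p r) ≤ volume K := by
        rw [← (hF.1 D hD).volume_eq, ← himg D z]
        exact measure_mono Set.inter_subset_left
      rw [Set.inter_eq_right.2 hsub, volume_box _ ht.le]
      exact mul_le_mul' hle le_rfl
  have hlow : ∀ r, F.card * volume K * volume (ball p (r + -ρ))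
      ≤ coverVol (periodization t (F : Set (Set (Euc d)))) p r * ENNReal.ofReal (t ^ d) := by
    intro r
    rw [coverVol_periodization ht hne hF hFc, Finset.sum_mul, mul_assoc, ← nsmul_eq_mul]
    refine Finset.card_nsmul_le_sum _ _ _ fun D hD => ?_
    rw [← tsum_volume_inter_box c ht (ball p (r + -ρ)), ← ENNReal.tsum_mul_right,
      ← ENNReal.tsum_mul_left]
    refine ENNReal.tsum_le_tsum fun z => ?_
    rcases Set.eq_empty_or_nonempty (ball p (r + -ρ) ∩ box (c + gridPoint t z) t)
      with h | ⟨x, hx⟩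
    · rw [h, measure_empty, mul_zero]
      exact zero_le
    · have hsub : (fun x => x + gridPoint t z) '' D ⊆ ball p r := fun y hy => by
        have h₁ := dist_le_of_mem_box (image_subset_box_add (hFc D hD) hy) hx.2
        have h₂ := dist_triangle y x p
        exact mem_ball.2 (by linarith [mem_ball.1 hx.1])
      rw [Set.inter_eq_left.2 hsub, himg, (hF.1 D hD).volume_eq, ← volume_box (c + gridPoint t z) ht.le]
      gcongr
      exact Set.inter_subset_right
  have hfin : ∀ r, F.card * volume K * volume (ball p r) ≠ ⊤ := fun r =>
    ENNReal.mul_ne_top (ENNReal.mul_ne_top (ENNReal.natCast_ne_top _) hVtop) measure_ball_lt_top.ne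
  have hreal : ∀ r, (F.card * volume K * volume (ball p r)).toReal = F.card * V * ballVol d r :=
    fun r => by
      rw [ENNReal.toReal_mul, ENNReal.toReal_mul, ENNReal.toReal_natCast, volume_ball_eq_ofReal,
        ENNReal.toReal_ofReal (ballVol_nonneg r)]
  have hlim : ∀ s : ℝ, Tendsto (fun r => F.card * V / t ^ d * (ballVol d (r + s) / ballVol d r))
      atTop (nhds (F.card * V / t ^ d)) := fun s => by
    simpa using (tendsto_ballVol_add_div (d := d) s).const_mul (F.card * V / t ^ d)
  have hform : ∀ s r : ℝ, F.card * V / t ^ d * (ballVol d (r + s) / ballVol d r)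
      = F.card * V * ballVol d (r + s) / t ^ d / ballVol d r := fun s r => by ring
  refine tendsto_of_tendsto_of_tendsto_of_le_of_le' (hlim (-ρ)) (hlim ρ) ?_ ?_
  · filter_upwards [eventually_gt_atTop 0] with r hr
    rw [ballFrac_eq, hform]
    refine div_le_div_of_nonneg_right ?_ (ballVol_nonneg r)
    have h := ENNReal.toReal_mono (ne_top_of_le_ne_top (hfin _) (hup r)) (hlow r)
    rw [ENNReal.toReal_mul (a := coverVol _ _ _), ENNReal.toReal_ofReal htd.le, hreal] at h
    rwa [div_le_iff₀ htd]
  · filter_upwards [eventually_gt_atTop 0] with r hr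
    rw [ballFrac_eq, hform]
    refine div_le_div_of_nonneg_right ?_ (ballVol_nonneg r)
    have h := ENNReal.toReal_mono (hfin _) (hup r)
    rw [ENNReal.toReal_mul (a := coverVol _ _ _), ENNReal.toReal_ofReal htd.le, hreal] at h
    rwa [le_div_iff₀ htd]

theorem packingDensity_nonneg (hK : IsBody K) (hne : K.Nonempty) : 0 ≤ packingDensity K := by
  have h := card_mul_volume_le_packingDensity hK hne one_pos (c := 0) (F := ∅)
    ⟨by simp, by simp [PairwiseDisjointInteriors]⟩ (by simp)
  simpa using h

end Periodization

section Averaging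

variable {d : ℕ} {K : Set (Euc d)}

theorem card_mul_volume_mul_le (hK : IsBody K) (hne : K.Nonempty) {a r : ℝ} (ha : 0 < a)
    {F : Finset (Set (Euc d))} (hF : IsPacking K (F : Set (Set (Euc d))))
    (hFr : ∀ D ∈ F, D ⊆ ball 0 r) :
    F.card * (volume K).toReal * a ^ d ≤
      packingDensity K * (a + 2 * (diam K + 1)) ^ d * ballVol d (r + √(d * a ^ 2)) := by
  classical
  have hR : 0 < diam K + 1 := by linarith [diam_nonneg (s := K)]
  set R := diam K + 1
  set ρ : ℝ := √(d * a ^ 2)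
  have hV := volume_toReal_pos hK hne
  set V : ℝ := (volume K).toReal
  have hex : ∀ D ∈ F, ∃ y, y ∈ D := fun D hD => (hF.1 D hD).nonempty hne
  choose! y hy using hex
  let S : Set (Euc d) → Set (Euc d) := fun D => {x | y D ∈ box x a}
  have hS : ∀ D, S D = (fun x => -x) ⁻¹' ((fun x => x + y D) ⁻¹' box 0 a) := by
    intro D
    ext x
    refine forall_congr' fun i => ?_
    simp only [PiLp.add_apply, PiLp.neg_apply, PiLp.zero_apply]
    constructor <;> rintro ⟨h₁, h₂⟩ <;> constructor <;> linarith
  have hSm : ∀ D, MeasurableSet (S D) := fun D => by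
    rw [hS]
    exact ((measurableSet_box _ _).preimage (measurable_add_const _)).preimage measurable_neg
  have hSv : ∀ D, volume (S D) = ENNReal.ofReal (a ^ d) := fun D => by
    rw [hS, Measure.measure_preimage_neg, measure_preimage_add_right, volume_box _ ha.le]
  set M : ℝ := packingDensity K * (a + 2 * R) ^ d / V with hM
  have hM0 : 0 ≤ M := by
    have := packingDensity_nonneg hK hne
    positivity
  have hpoint : ∀ x, ∑ D ∈ F, (S D).indicator (fun _ => (1 : ℝ≥0∞)) x
      ≤ (ball (0 : Euc d) (r + ρ)).indicator (fun _ => ENNReal.ofReal M) x := by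
    intro x
    have hsum : ∑ D ∈ F, (S D).indicator (fun _ => (1 : ℝ≥0∞)) x
        = ((F.filter fun D => x ∈ S D).card : ℝ≥0∞) := by
      simp [Set.indicator_apply]
    rw [hsum]
    by_cases hx : x ∈ ball (0 : Euc d) (r + ρ)
    · rw [Set.indicator_of_mem hx, ← ENNReal.ofReal_natCast]
      refine ENNReal.ofReal_le_ofReal ?_
      rw [hM, le_div_iff₀ hV]
      refine card_mul_volume_le_packingDensity hK hne (by linarith)
        (c := x - WithLp.toLp 2 fun _ => R)
        (hF.subset (Finset.coe_subset.2 (Finset.filter_subset _ _))) fun D hD w hw i => ?_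
      obtain ⟨hDF, hxD⟩ := Finset.mem_filter.1 hD
      have h₁ := mem_ball.1 ((hF.1 D hDF).subset_ball hK.1 (hy D hDF) hw)
      have h₂ := abs_le.1 ((abs_sub_le_dist w (y D) i).trans h₁.le)
      have h₃ := hxD i
      simp only [PiLp.sub_apply]
      constructor <;> linarith [h₂.1, h₂.2, h₃.1, h₃.2]
    · rw [Set.indicator_of_notMem hx, nonpos_iff_eq_zero, Nat.cast_eq_zero,
        Finset.card_eq_zero, Finset.filter_eq_empty_iff]
      intro D hD hxD
      refine hx (mem_ball.2 ?_)
      have hxx : x ∈ box x a := fun i => ⟨le_rfl, by linarith⟩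
      have h₁ := dist_le_of_mem_box hxx hxD
      have h₂ := mem_ball.1 (hFr D hD (hy D hD))
      linarith [dist_triangle x (y D) 0]
  have hint := lintegral_mono (μ := volume) hpoint
  rw [lintegral_finsetSum _ fun D _ => measurable_const.indicator (hSm D),
    lintegral_indicator_const measurableSet_ball,
    Finset.sum_congr rfl fun D _ => by rw [lintegral_indicator_const (hSm D), one_mul, hSv],
    Finset.sum_const, nsmul_eq_mul, volume_ball_eq_ofReal, ← ENNReal.ofReal_natCast,
    ← ENNReal.ofReal_mul (Nat.cast_nonneg _), ← ENNReal.ofReal_mul hM0,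
    ENNReal.ofReal_le_ofReal_iff (mul_nonneg hM0 (ballVol_nonneg _)), hM,
    div_mul_eq_mul_div, le_div_iff₀ hV] at hint
  linarith

/-- Finite packings in large balls are asymptotically no denser than `packingDensity K`. -/
theorem eventually_card_mul_volume_le (hK : IsBody K) (hne : K.Nonempty) {η : ℝ} (hη : 0 < η) :
    ∀ᶠ r in atTop, ∀ F : Finset (Set (Euc d)), IsPacking K (F : Set (Set (Euc d))) →
      (∀ D ∈ F, D ⊆ ball 0 r) →
      F.card * (volume K).toReal ≤ (packingDensity K + η) * ballVol d r := by
  set R := diam K + 1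
  have h₁ : Tendsto (fun a : ℝ => packingDensity K * (1 + 2 * R / a) ^ d) atTop
      (nhds (packingDensity K)) := by
    simpa using (((tendsto_const_nhds (x := 2 * R)).div_atTop tendsto_id).const_add 1 |>.pow
      d).const_mul (packingDensity K)
  obtain ⟨a, haη, ha⟩ := ((h₁.eventually_lt_const (lt_add_of_pos_right _ hη)).and
    (eventually_gt_atTop 0)).exists
  have h₂ : Tendsto (fun r => packingDensity K * (1 + 2 * R / a) ^ d *
      (ballVol d (r + √(d * a ^ 2)) / ballVol d r)) atTop
      (nhds (packingDensity K * (1 + 2 * R / a) ^ d * 1)) :=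
    (tendsto_ballVol_add_div _).const_mul _
  rw [mul_one] at h₂
  filter_upwards [h₂.eventually_lt_const haη, eventually_gt_atTop 0] with r hr hr0 F hF hFr
  have h₃ := card_mul_volume_mul_le hK hne ha hF hFr
  have had : 0 < a ^ d := pow_pos ha d
  rw [← le_div_iff₀ had] at h₃
  refine h₃.trans ?_
  rw [← div_le_iff₀ (ballVol_pos hr0)]
  refine le_of_eq_of_le ?_ hr.le
  have : (1 + 2 * R / a) ^ d = (a + 2 * R) ^ d / a ^ d := by
    rw [← div_pow, add_div, div_self ha.ne']
  rw [this]
  ring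

end Averaging

section Replacement

variable {d : ℕ} {K : Set (Euc d)} {P : Set (Set (Euc d))}

theorem IsPacking.finite_inside (hK : IsBody K) (hne : K.Nonempty) (hP : IsPacking K P)
    (x : Euc d) (r : ℝ) : (inside P x r).Finite :=
  (hP.finite_touching hK hne x r).subset (inside_subset_touching hne hP x r)

/-- Replace the elements of `P` that meet each of the given disjoint balls by a translate of
`inside P x₁ s`. -/
theorem IsPacking.exists_replacement (hK : IsBody K) (hne : K.Nonempty) (hP : IsPacking K P)
    {ι : Type*} {J : Finset ι} {x : ι → Euc d} {x₁ : Euc d} {s r : ℝ}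
    (hdisj : (J : Set ι).PairwiseDisjoint fun z => ball (x z) s)
    (hsub : ∀ z ∈ J, ball (x z) s ⊆ ball 0 r)
    (hcard : ∀ z ∈ J, (touching P (x z) s).ncard < (inside P x₁ s).ncard) :
    ∃ F : Finset (Set (Euc d)), IsPacking K (F : Set (Set (Euc d))) ∧
      (∀ D ∈ F, D ⊆ ball 0 (r + (diam K + 1))) ∧
      (touching P 0 r).ncard + J.card ≤ F.card := by
  classical
  have hR : 0 < diam K + 1 := by linarith [diam_nonneg (s := K)]
  have hT := hP.finite_touching hK hne
  have hI := hP.finite_inside hK hne x₁ s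
  let old : Finset (Set (Euc d)) := (hT 0 r).toFinset \ J.biUnion fun z => (hT (x z) s).toFinset
  let new : ι → Finset (Set (Euc d)) := fun z =>
    hI.toFinset.image fun D => (fun y => y + (x z - x₁)) '' D
  have hnew_packing : ∀ z, IsPacking K (new z : Set (Set (Euc d))) := fun z => by
    have h := (hP.subset (fun _ h => h.1 : inside P x₁ s ⊆ P)).translate (x z - x₁)
    simpa [new, translatePacking] using h
  have hnew_sub : ∀ z, ∀ D ∈ new z, D ⊆ ball (x z) s := by
    intro z D hD
    obtain ⟨E, hE, rfl⟩ := Finset.mem_image.1 hD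
    rintro _ ⟨y, hy, rfl⟩
    have h := mem_ball.1 ((hI.mem_toFinset.1 hE).2 hy)
    rw [mem_ball, dist_eq_norm] at *
    rwa [add_sub_assoc, sub_sub_cancel_left, ← sub_eq_add_neg]
  have hnew_card : ∀ z, (new z).card = (inside P x₁ s).ncard := fun z => by
    rw [Finset.card_image_of_injective _ (Set.image_injective.2 (add_left_injective _)),
      Set.ncard_eq_toFinset_card _ hI]
  have hold_new : ∀ z ∈ J, ∀ D ∈ old, ∀ E ∈ new z, Disjoint D E := by
    intro z hz D hD E hE
    rw [Set.disjoint_left]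
    intro y hyD hyE
    obtain ⟨hDT, hDJ⟩ := Finset.mem_sdiff.1 hD
    exact hDJ (Finset.mem_biUnion.2 ⟨z, hz, (hT (x z) s).mem_toFinset.2
      ⟨((hT 0 r).mem_toFinset.1 hDT).1, y, hyD, hnew_sub z E hE hyE⟩⟩)
  have hnew_new : ∀ z ∈ J, ∀ w ∈ J, z ≠ w → ∀ D ∈ new z, ∀ E ∈ new w, Disjoint D E :=
    fun z hz w hw hzw D hD E hE =>
      (hdisj hz hw hzw).mono (hnew_sub z D hD) (hnew_sub w E hE)
  have hint : ∀ {D E : Set (Euc d)}, Disjoint D E → interior D ∩ interior E = ∅ := fun h =>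
    Set.disjoint_iff_inter_eq_empty.1 (h.mono interior_subset interior_subset)
  have hself : ∀ {Q : Set (Set (Euc d))}, IsPacking K Q → ∀ D ∈ Q, ¬ Disjoint D D :=
    fun hQ D hD h => ((hQ.1 D hD).nonempty hne).ne_empty (disjoint_self.1 h)
  have hold_packing : IsPacking K (old : Set (Set (Euc d))) := hP.subset fun D hD =>
    ((hT 0 r).mem_toFinset.1 (Finset.mem_sdiff.1 hD).1).1
  have hdisj_new : (J : Set ι).PairwiseDisjoint new := fun z hz w hw hzw =>
    Finset.disjoint_left.2 fun D hD hD' =>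
      hself (hnew_packing z) D hD (hnew_new z hz w hw hzw D hD D hD')
  have hdisj_old : Disjoint old (J.biUnion new) := Finset.disjoint_left.2 fun D hD hD' => by
    obtain ⟨z, hz, hDz⟩ := Finset.mem_biUnion.1 hD'
    exact hself (hnew_packing z) D hDz (hold_new z hz D hD D hDz)
  refine ⟨old ∪ J.biUnion new, ⟨fun D hD => ?_, fun D hD E hE hDE => ?_⟩, fun D hD => ?_, ?_⟩
  · rcases Finset.mem_union.1 hD with hD | hD
    · exact hold_packing.1 D hD
    · obtain ⟨z, -, hDz⟩ := Finset.mem_biUnion.1 hD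
      exact (hnew_packing z).1 D hDz
  · rcases Finset.mem_union.1 hD with hD | hD <;> rcases Finset.mem_union.1 hE with hE | hE
    · exact hold_packing.2 hD hE hDE
    · obtain ⟨z, hz, hEz⟩ := Finset.mem_biUnion.1 hE
      exact hint (hold_new z hz D hD E hEz)
    · obtain ⟨z, hz, hDz⟩ := Finset.mem_biUnion.1 hD
      exact hint (hold_new z hz E hE D hDz).symm
    · obtain ⟨z, hz, hDz⟩ := Finset.mem_biUnion.1 hD
      obtain ⟨w, hw, hEw⟩ := Finset.mem_biUnion.1 hE
      rcases eq_or_ne z w with rfl | hzw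
      · exact (hnew_packing z).2 hDz hEw hDE
      · exact hint (hnew_new z hz w hw hzw D hDz E hEw)
  · rcases Finset.mem_union.1 hD with hD | hD
    · exact hP.touching_subset_ball hK le_rfl
        ((hT 0 r).mem_toFinset.1 (Finset.mem_sdiff.1 hD).1)
    · obtain ⟨z, hz, hDz⟩ := Finset.mem_biUnion.1 hD
      exact ((hnew_sub z D hDz).trans (hsub z hz)).trans (ball_subset_ball (by linarith))
  · have h₁ := Finset.card_le_card_sdiff_add_card (t := J.biUnion fun z => (hT (x z) s).toFinset)
      (s := (hT 0 r).toFinset)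
    have h₂ : (J.biUnion fun z => (hT (x z) s).toFinset).card + J.card
        ≤ ∑ z ∈ J, (new z).card := by
      refine (Nat.add_le_add_right Finset.card_biUnion_le _).trans ?_
      rw [Finset.card_eq_sum_ones J, ← Finset.sum_add_distrib]
      refine Finset.sum_le_sum fun z hz => ?_
      rw [hnew_card, ← Set.ncard_eq_toFinset_card _ (hT (x z) s)]
      exact hcard z hz
    rw [Finset.card_union_of_disjoint hdisj_old, Finset.card_biUnion hdisj_new,
      Set.ncard_eq_toFinset_card _ (hT 0 r)]
    change _ ≤ ((hT 0 r).toFinset \ J.biUnion fun z => (hT (x z) s).toFinset).card + _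
    omega

theorem finite_setOf_norm_gridPoint_le {t : ℝ} (ht : 0 < t) (r : ℝ) :
    {z : Fin d → ℤ | ‖gridPoint t z‖ ≤ r}.Finite := by
  refine (Set.finite_Icc (fun _ => -⌈r / t⌉) fun _ => ⌈r / t⌉).subset fun z hz => ?_
  have h : ∀ i, |(z i : ℝ)| ≤ ⌈r / t⌉ := fun i => by
    have h₁ := (PiLp.norm_apply_le (gridPoint t z) i).trans hz
    rw [gridPoint_apply, Real.norm_eq_abs, abs_mul, abs_of_pos ht, mul_comm,
      ← le_div_iff₀ ht] at h₁
    exact h₁.trans (Int.le_ceil _)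
  constructor <;> intro i
  · exact_mod_cast (abs_le.1 (h i)).1
  · exact_mod_cast (abs_le.1 (h i)).2

theorem ballVol_le_card_gridPoint_mul {t : ℝ} (ht : 0 < t) (r : ℝ) :
    ballVol d (r + -√(d * t ^ 2)) ≤
      (finite_setOf_norm_gridPoint_le (d := d) ht r).toFinset.card * t ^ d := by
  set J := (finite_setOf_norm_gridPoint_le (d := d) ht r).toFinset
  have h : volume (ball (0 : Euc d) (r + -√(d * t ^ 2))) ≤ J.card * ENNReal.ofReal (t ^ d) := by
    have hzero : ∀ z ∉ J, volume (ball (0 : Euc d) (r + -√(d * t ^ 2)) ∩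
        box (0 + gridPoint t z) t) = 0 := by
      intro z hz
      rw [Set.Finite.mem_toFinset] at hz
      refine measure_mono_null (fun y hy => hz ?_) measure_empty
      have hmem : 0 + gridPoint t z ∈ box (0 + gridPoint t z) t :=
        fun i => ⟨le_rfl, by linarith⟩
      have h₁ := dist_le_of_mem_box hmem hy.2
      have h₂ := mem_ball.1 hy.1
      have h₃ := dist_triangle (0 + gridPoint t z) y 0
      rw [zero_add, dist_zero_right] at h₃
      rw [zero_add] at h₁
      show ‖gridPoint t z‖ ≤ r
      linarith
    rw [← tsum_volume_inter_box 0 ht, tsum_eq_sum hzero,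
      ← nsmul_eq_mul J.card]
    refine Finset.sum_le_card_nsmul _ _ _ fun z _ => ?_
    rw [← volume_box (0 + gridPoint t z) ht.le]
    exact measure_mono Set.inter_subset_right
  have h' := ENNReal.toReal_mono
    (ENNReal.mul_ne_top (ENNReal.natCast_ne_top _) ENNReal.ofReal_ne_top) h
  rwa [ENNReal.toReal_mul, ENNReal.toReal_natCast, ENNReal.toReal_ofReal (by positivity)] at h'

end Replacement

section UniformDensity

variable {d : ℕ} {K : Set (Euc d)} {P : Set (Set (Euc d))}

/-- In a uniformly recurrent dense packing, no ball contains more elements than meet a slightly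
larger ball elsewhere. -/
theorem UniformlyRecurrent.ncard_inside_le (hK : IsBody K) (hne : K.Nonempty)
    (hP : IsPacking K P) (hur : UniformlyRecurrent K P) (hd : HasDensity P (packingDensity K))
    (x₀ x₁ : Euc d) (s : ℝ) :
    (inside P x₁ s).ncard ≤ (touching P x₀ (s + 1)).ncard := by
  by_contra! hlt
  obtain ⟨L, hL, hx⟩ := hur.exists_forall_dist_le hK hne hP x₀ s
  choose x hxL hxN using hx
  set R := diam K + 1
  set t := 2 * L + 2 * |s| + 1 with ht_def
  have hs := le_abs_self s
  have ht : 0 < t := by positivity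
  set ρ := √(d * t ^ 2)
  have hV := volume_toReal_pos hK hne
  set V := (volume K).toReal
  have hfew : ∀ y, (touching P (x y) s).ncard < (inside P x₁ s).ncard := fun y =>
    lt_of_le_of_lt (ENat.toNat_le_toNat (hxN y)
      (hP.finite_touching hK hne x₀ (s + 1)).encard_lt_top.ne) hlt
  have hdisj : ∀ J : Set (Fin d → ℤ),
      J.PairwiseDisjoint fun z => ball (x (gridPoint t z)) s := by
    intro J z _ w _ hzw
    refine ball_disjoint_ball ?_
    obtain ⟨i, hi⟩ := Function.ne_iff.1 hzw
    have h₁ : t ≤ |gridPoint t z i - gridPoint t w i| := by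
      rw [gridPoint_apply, gridPoint_apply, ← mul_sub, abs_mul, abs_of_pos ht]
      refine le_mul_of_one_le_right ht.le ?_
      rw [← Int.cast_sub, ← Int.cast_abs]
      exact_mod_cast Int.one_le_abs (sub_ne_zero.2 hi)
    have h₂ := abs_sub_le_dist (gridPoint t z) (gridPoint t w) i
    have h₃ := dist_triangle4 (gridPoint t z) (x (gridPoint t z)) (x (gridPoint t w))
      (gridPoint t w)
    rw [dist_comm (gridPoint t z)  (x _)] at h₃
    linarith [hxL (gridPoint t z), hxL (gridPoint t w)]
  set δ := packingDensity K
  have htd : 0 < t ^ d := pow_pos ht d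
  have hgain : ∀ η : ℝ, 0 < η → δ + V / t ^ d ≤ δ + η := by
    intro η hη
    have hlim₁ : Tendsto (fun r => ballFrac P 0 r
          + V / t ^ d * (ballVol d (r + (-(L + |s|) + -ρ)) / ballVol d r)) atTop
        (nhds (δ + V / t ^ d * 1)) := (hd 0).add ((tendsto_ballVol_add_div _).const_mul _)
    have hlim₂ : Tendsto (fun r => (δ + η) * (ballVol d (r + R) / ballVol d r)) atTop
        (nhds ((δ + η) * 1)) := (tendsto_ballVol_add_div _).const_mul _
    rw [mul_one] at hlim₁ hlim₂
    refine le_of_tendsto_of_tendsto hlim₁ hlim₂ ?_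
    filter_upwards [eventually_gt_atTop 0, (tendsto_atTop_add_const_right atTop R
      tendsto_id).eventually (eventually_card_mul_volume_le hK hne hη)] with r hr hrF
    have hJvol := ballVol_le_card_gridPoint_mul (d := d) ht (r + -(L + |s|))
    set hfin := finite_setOf_norm_gridPoint_le (d := d) ht (r + -(L + |s|))
    obtain ⟨F, hF, hFr, hFcard⟩ := hP.exists_replacement hK hne (J := hfin.toFinset)
      (x := fun z => x (gridPoint t z)) (x₁ := x₁) (s := s) (r := r) (hdisj _)
      (fun z hz y hy => by
        have h₁ : ‖gridPoint t z‖ ≤ r + -(L + |s|) := hfin.mem_toFinset.1 hz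
        have h₂ := mem_ball.1 hy
        have h₃ := dist_triangle4 y (x (gridPoint t z)) (gridPoint t z) 0
        rw [dist_zero_right (gridPoint t z)] at h₃
        exact mem_ball.2 (by linarith [hxL (gridPoint t z)]))
      fun z _ => hfew _
    have h₁ := hrF F hF hFr
    have h₂ := coverVol_toReal_le hK hne hP 0 r
    have h₃ : ((touching P 0 r).ncard : ℝ) + hfin.toFinset.card ≤ F.card := by
      exact_mod_cast hFcard
    have h₄ : V / t ^ d * ballVol d (r + (-(L + |s|) + -ρ)) ≤ V * hfin.toFinset.card := by
      rw [div_mul_eq_mul_div, div_le_iff₀ htd, mul_assoc, ← add_assoc]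
      exact mul_le_mul_of_nonneg_left hJvol hV.le
    rw [ballFrac_eq, mul_div_assoc', ← add_div, mul_div_assoc']
    refine div_le_div_of_nonneg_right ?_ (ballVol_nonneg r)
    have h₅ := mul_le_mul_of_nonneg_right h₃ hV.le
    simp only [id] at h₁
    linarith
  have hpos : 0 < V / t ^ d := div_pos hV htd
  linarith [hgain (V / t ^ d / 2) (half_pos hpos)]

theorem UniformlyRecurrent.coverVol_toReal_le (hK : IsBody K) (hne : K.Nonempty)
    (hP : IsPacking K P) (hur : UniformlyRecurrent K P) (hd : HasDensity P (packingDensity K))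
    (p q : Euc d) {r s : ℝ} (hrs : r + (2 * (diam K + 1) + 1) ≤ s) :
    (coverVol P p r).toReal ≤ (coverVol P q s).toReal := by
  have hT := hP.finite_touching hK hne
  refine (_root_.coverVol_toReal_le hK hne hP p r).trans
    (le_trans ?_ (le_coverVol_toReal hK hne hP q s))
  refine mul_le_mul_of_nonneg_right (Nat.cast_le.2 ?_) ENNReal.toReal_nonneg
  calc (touching P p r).ncard
      ≤ (inside P p (r + (diam K + 1))).ncard :=
        Set.ncard_le_ncard (hP.touching_subset_inside hK le_rfl) (hP.finite_inside hK hne _ _)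
    _ ≤ (touching P q (r + (diam K + 1) + 1)).ncard :=
        hur.ncard_inside_le hK hne hP hd q p _
    _ ≤ (inside P q s).ncard :=
        Set.ncard_le_ncard (hP.touching_subset_inside hK (by linarith))
          (hP.finite_inside hK hne _ _)

theorem UniformlyRecurrent.hasUniformDensity (hK : IsBody K) (hne : K.Nonempty)
    (hP : IsPacking K P) (hur : UniformlyRecurrent K P) (hd : HasDensity P (packingDensity K)) :
    HasUniformDensity P (packingDensity K) := by
  set δ := packingDensity K
  set c := 2 * (diam K + 1) + 1
  have hlim : ∀ a : ℝ, Tendsto (fun r => ballFrac P 0 (r + a) *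
      (ballVol d (r + a) / ballVol d r)) atTop (nhds δ) := fun a => by
    simpa using ((hd 0).comp (tendsto_atTop_add_const_right atTop a tendsto_id)).mul
      (tendsto_ballVol_add_div (d := d) a)
  have heq : ∀ a r : ℝ, 0 < r + a → ballFrac P 0 (r + a) * (ballVol d (r + a) / ballVol d r)
      = (coverVol P 0 (r + a)).toReal / ballVol d r := fun a r h => by
    rw [ballFrac_eq, div_mul_div_cancel₀ (ballVol_pos h).ne']
  rw [HasUniformDensity, Metric.tendstoUniformly_iff]
  intro ε hε
  filter_upwards [(hlim c).eventually_lt_const (lt_add_of_pos_right δ hε),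
    (hlim (-c)).eventually_const_lt (sub_lt_self δ hε), eventually_gt_atTop 0,
    eventually_gt_atTop c, eventually_gt_atTop (-c)] with r h₁ h₂ hr hrc hrc' p
  rw [heq _ _ (by linarith)] at h₁ h₂
  have h₃ := div_le_div_of_nonneg_right
    (hur.coverVol_toReal_le hK hne hP hd p 0 (r := r) le_rfl) (ballVol_nonneg (d := d) r)
  have h₄ := div_le_div_of_nonneg_right
    (hur.coverVol_toReal_le hK hne hP hd 0 p (r := r + -c) (s := r)
      (by linarith)) (ballVol_nonneg (d := d) r)
  rw [← ballFrac_eq] at h₃ h₄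
  rw [dist_comm, Real.dist_eq, abs_lt]
  constructor <;> linarith

theorem ballFrac_eq_zero_of_isPacking_empty (hP : IsPacking (∅ : Set (Euc d)) P) (p : Euc d)
    (r : ℝ) : ballFrac P p r = 0 := by
  have h : ∀ D : P, volume ((D : Set (Euc d)) ∩ ball p r) = 0 := fun D => by
    obtain ⟨f, hf⟩ := hP.1 D D.2
    rw [hf, Set.image_empty, Set.empty_inter, measure_empty]
  simp [ballFrac, h]

end UniformDensity

/-- A uniformly recurrent dense packing is uniformly dense. -/
theorem uniformly_recurrent_dense_is_uniformly_dense {d : ℕ} (K : Set (Euc d))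
    (hK : IsBody K) (P : Set (Set (Euc d))) (hP : IsPacking K P)
    (hur : UniformlyRecurrent K P)
    (hd : HasDensity P (packingDensity K)) :
    HasUniformDensity P (packingDensity K) := by
  rcases K.eq_empty_or_nonempty with rfl | hne
  · have h0 : packingDensity (∅ : Set (Euc d)) = 0 := by
      refine tendsto_nhds_unique (hd 0) ?_
      simp [ballFrac_eq_zero_of_isPacking_empty hP]
    rw [h0, HasUniformDensity, Metric.tendstoUniformly_iff]
    exact fun ε hε => .of_forall fun r p => by
      rwa [ballFrac_eq_zero_of_isPacking_empty hP, dist_self]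
  · exact hur.hasUniformDensity hK hne hP hd
end
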